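/- Let y_a be the polynomial y_a(x) = t¹¹/1929701 − t¹⁰/625758 − t⁹/192428 + t⁸/27779 − t⁷/23450 − 13t⁶/44056 + 90t⁵/64211 − 19t⁴/21788 − 125t³/9667 + 1535t²/28314 − 2759t/28279 + 1413/19685 with t = x − 3/2, and let R₃(x) := y_a''(x) − 2y_a(x)³ − x·y_a(x). Then |R₃(x)| < 18·10⁻⁶ for all x ∈ [0, 3]. -/

import Mathlib

open Set

/-- The degree-11 polynomial quasi-solution `y_a` on `[0, 3]`, in the variable `t = x − 3/2`. -/
noncomputable def ya (x : ℝ) : ℝ :=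
  (x - 3/2) ^ 11 / 1929701 - (x - 3/2) ^ 10 / 625758 - (x - 3/2) ^ 9 / 192428
    + (x - 3/2) ^ 8 / 27779 - (x - 3/2) ^ 7 / 23450 - 13 * (x - 3/2) ^ 6 / 44056
    + 90 * (x - 3/2) ^ 5 / 64211 - 19 * (x - 3/2) ^ 4 / 21788 - 125 * (x - 3/2) ^ 3 / 9667
    + 1535 * (x - 3/2) ^ 2 / 28314 - 2759 * (x - 3/2) / 28279 + 1413 / 19685

/-- The remainder `R₃ = y_a'' − 2y_a³ − x y_a` obtained by substituting `y_a` into the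
Painlevé II equation. -/
noncomputable def R3 (x : ℝ) : ℝ :=
  deriv (deriv ya) x - 2 * ya x ^ 3 - x * ya x

/-- Value at `t` of the polynomial with the given coefficients, constant term first. -/
noncomputable def evalCoeffs : List ℚ → ℝ → ℝ
  | [], _ => 0
  | a :: l, t => a + t * evalCoeffs l t

/-- Coefficients of the sum of two polynomials. -/
def addCoeffs : List ℚ → List ℚ → List ℚ
  | [], m => m
  | a :: l, [] => a :: l
  | a :: l, b :: m => (a + b) :: addCoeffs l m

/-- Coefficients of the product of a polynomial with a constant. -/
def smulCoeffs (c : ℚ) : List ℚ → List ℚ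
  | [] => []
  | a :: l => (c * a) :: smulCoeffs c l

/-- Coefficients of the product of two polynomials. -/
def mulCoeffs : List ℚ → List ℚ → List ℚ
  | [], _ => []
  | a :: l, m => addCoeffs (smulCoeffs a m) (0 :: mulCoeffs l m)

/-- Coefficients of the derivative of a polynomial. -/
def derivCoeffs : List ℚ → List ℚ
  | [] => []
  | _ :: l => addCoeffs l (0 :: derivCoeffs l)

/-- Coefficients of `a + (c + X) * p`, where `p` has the given coefficients. -/
def shiftStep (c : ℚ) : ℚ → List ℚ → List ℚ
  | a, [] => [a]
  | a, b :: l => (a + c * b) :: shiftStep c b l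

/-- Coefficients of `p (c + X)`, where `p` has the given coefficients. -/
def taylorCoeffs (c : ℚ) : List ℚ → List ℚ
  | [] => []
  | a :: l => shiftStep c a (taylorCoeffs c l)

/-- The polynomial with the absolute values of the given coefficients, evaluated at `h`. -/
def absBound (h : ℚ) : List ℚ → ℚ
  | [] => 0
  | a :: l => |a| + h * absBound h l

theorem evalCoeffs_add (l m : List ℚ) (t : ℝ) :
    evalCoeffs (addCoeffs l m) t = evalCoeffs l t + evalCoeffs m t := by
  induction l generalizing m with
  | nil => simp [addCoeffs, evalCoeffs]
  | cons a l ih =>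
    cases m with
    | nil => simp [addCoeffs, evalCoeffs]
    | cons b m =>
      simp only [addCoeffs, evalCoeffs, ih]
      push_cast
      ring

theorem evalCoeffs_smul (c : ℚ) (l : List ℚ) (t : ℝ) :
    evalCoeffs (smulCoeffs c l) t = c * evalCoeffs l t := by
  induction l with
  | nil => simp [smulCoeffs, evalCoeffs]
  | cons a l ih =>
    simp only [smulCoeffs, evalCoeffs, ih]
    push_cast
    ring

theorem evalCoeffs_mul (l m : List ℚ) (t : ℝ) :
    evalCoeffs (mulCoeffs l m) t = evalCoeffs l t * evalCoeffs m t := by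
  induction l with
  | nil => simp [mulCoeffs, evalCoeffs]
  | cons a l ih =>
    simp only [mulCoeffs, evalCoeffs, evalCoeffs_add, evalCoeffs_smul, ih]
    push_cast
    ring

theorem hasDerivAt_evalCoeffs (l : List ℚ) (t : ℝ) :
    HasDerivAt (evalCoeffs l) (evalCoeffs (derivCoeffs l) t) t := by
  induction l with
  | nil => exact hasDerivAt_const t 0
  | cons a l ih =>
    have h := ((hasDerivAt_id t).mul ih).const_add (a : ℝ)
    refine h.congr_deriv ?_
    simp only [derivCoeffs, evalCoeffs, evalCoeffs_add, id]
    push_cast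
    ring

theorem evalCoeffs_shiftStep (c a : ℚ) (l : List ℚ) (t : ℝ) :
    evalCoeffs (shiftStep c a l) t = a + (c + t) * evalCoeffs l t := by
  induction l generalizing a with
  | nil => simp [shiftStep, evalCoeffs]
  | cons b l ih =>
    simp only [shiftStep, evalCoeffs, ih]
    push_cast
    ring

theorem evalCoeffs_taylor (c : ℚ) (l : List ℚ) (t : ℝ) :
    evalCoeffs (taylorCoeffs c l) t = evalCoeffs l (c + t) := by
  induction l with
  | nil => rfl
  | cons a l ih => simp only [taylorCoeffs, evalCoeffs, evalCoeffs_shiftStep, ih]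

theorem abs_evalCoeffs_le {h : ℚ} {t : ℝ} (ht : |t| ≤ h) (l : List ℚ) :
    |evalCoeffs l t| ≤ absBound h l := by
  induction l with
  | nil => simp [evalCoeffs, absBound]
  | cons a l ih =>
    simp only [evalCoeffs, absBound]
    push_cast
    calc |(a : ℝ) + t * evalCoeffs l t| ≤ |(a : ℝ)| + |t * evalCoeffs l t| := abs_add_le _ _
      _ ≤ |(a : ℝ)| + h * absBound h l := by
        rw [abs_mul]
        gcongr
        exact (abs_nonneg t).trans ht

/-- Coefficients of `ya` in powers of `x - 3/2`. -/
def yaCoeffs : List ℚ :=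
  [1413 / 19685, -2759 / 28279, 1535 / 28314, -125 / 9667, -19 / 21788, 90 / 64211,
    -13 / 44056, -1 / 23450, 1 / 27779, -1 / 192428, -1 / 625758, 1 / 1929701]

/-- Coefficients of `R3` in powers of `x - 3/2`. -/
def R3Coeffs : List ℚ :=
  addCoeffs (derivCoeffs (derivCoeffs yaCoeffs))
    (mulCoeffs (addCoeffs (smulCoeffs (-2) (mulCoeffs yaCoeffs yaCoeffs)) [-3 / 2, -1]) yaCoeffs)

theorem ya_eq_evalCoeffs : ya = fun x => evalCoeffs yaCoeffs (x - 3 / 2) := by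
  funext x
  simp only [ya, yaCoeffs, evalCoeffs]
  push_cast
  ring

theorem deriv_evalCoeffs_sub (l : List ℚ) (c : ℝ) :
    deriv (fun x => evalCoeffs l (x - c)) = fun x => evalCoeffs (derivCoeffs l) (x - c) :=
  funext fun x => ((hasDerivAt_evalCoeffs l (x - c)).comp_sub_const x c).deriv

theorem R3_eq_evalCoeffs (x : ℝ) : R3 x = evalCoeffs R3Coeffs (x - 3 / 2) := by
  simp only [R3, R3Coeffs, ya_eq_evalCoeffs, deriv_evalCoeffs_sub, evalCoeffs_add, evalCoeffs_mul,
    evalCoeffs_smul]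
  simp only [evalCoeffs]
  push_cast
  ring

/-- Centers and radii of closed intervals covering `[-3/2, 3/2]`. -/
def coverPieces : List (ℚ × ℚ) :=
  [(-23 / 16, 1 / 16), (-19 / 16, 3 / 16), (-3 / 4, 1 / 4), (-3 / 8, 1 / 8), (-1 / 16, 3 / 16),
    (3 / 8, 1 / 4), (7 / 8, 1 / 4), (21 / 16, 3 / 16)]

theorem exists_mem_coverPieces {t : ℝ} (h₀ : -3 / 2 ≤ t) (h₁ : t ≤ 3 / 2) :
    ∃ p ∈ coverPieces, |t - p.1| ≤ p.2 := by
  simp only [coverPieces, List.mem_cons, List.not_mem_nil, or_false, exists_eq_or_imp,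
    exists_eq_left, abs_le]
  push_cast
  grind

theorem absBound_taylorCoeffs_R3Coeffs_lt :
    ∀ p ∈ coverPieces, absBound p.2 (taylorCoeffs p.1 R3Coeffs) < 18 / 10 ^ 6 := by
  decide +kernel

/-- `|R₃(x)| < 18·10⁻⁶` on `[0, 3]`. -/
theorem R3_bound : ∀ x ∈ Icc (0 : ℝ) 3, |R3 x| < 18 / 10 ^ 6 := by
  rintro x ⟨h0, h3⟩
  rw [R3_eq_evalCoeffs]
  obtain ⟨⟨c, h⟩, hp, ht⟩ :=
    exists_mem_coverPieces (t := x - 3 / 2) (by linarith) (by linarith)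
  have hle := abs_evalCoeffs_le ht (taylorCoeffs c R3Coeffs)
  rw [evalCoeffs_taylor, add_sub_cancel] at hle
  have hlt : ((absBound h (taylorCoeffs c R3Coeffs) : ℚ) : ℝ) < ((18 / 10 ^ 6 : ℚ) : ℝ) :=
    Rat.cast_lt.2 (absBound_taylorCoeffs_R3Coeffs_lt (c, h) hp)
  push_cast at hlt
  exact hle.trans_lt hlt
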